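/- Let a, b ∈ (-1,1) with a + b > 0. Then for every f ∈ Ḣ^a(ℝ²) and g ∈ Ḣ^b(ℝ²), the product fg belongs to Ḣ^{a+b-1}(ℝ²) and there is a constant C depending only on a,b such that ‖fg‖_{Ḣ^{a+b-1}} ≤ C ‖f‖_{Ḣ^a} ‖g‖_{Ḣ^b}. -/

import Mathlib

open MeasureTheory Real
open scoped FourierTransform ENNReal NNReal

noncomputable section

abbrev R2 := EuclideanSpace ℝ (Fin 2)

/-- The squared homogeneous Sobolev norm `‖f‖_{Ḣ^s}² = ∫ |ξ|^{2s} |f̂(ξ)|² dξ` on `ℝ²`. -/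
def hSobSq (s : ℝ) (f : R2 → ℂ) : ℝ≥0∞ :=
  ∫⁻ ξ : R2, (‖ξ‖₊ : ℝ≥0∞) ^ (2 * s) * (‖𝓕 f ξ‖₊ : ℝ≥0∞) ^ (2 : ℝ)


lemma sob_selfadj {u v : R2 → ℂ} (hu : Integrable u) (hv : Integrable v) :
    ∫ ξ, v ξ * 𝓕 u ξ = ∫ x, 𝓕 v x * u x := by
  have h := VectorFourier.integral_fourierIntegral_smul_eq_flip (μ := volume) (ν := volume)
    (L := innerₗ R2) (e := Real.fourierChar) (f := v) (g := u)
    Real.continuous_fourierChar continuous_inner hv hu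
  rw [flip_innerₗ] at h
  exact h.symm

lemma sob_ae_eq {u v : R2 → ℂ} (hu : LocallyIntegrable u) (hv : LocallyIntegrable v)
    (h : ∀ φ : SchwartzMap R2 ℂ, ∫ x, φ x * u x = ∫ x, φ x * v x) : u =ᵐ[volume] v := by
  apply ae_eq_of_integral_contDiff_smul_eq hu hv
  intro g g_smooth g_cpt
  have hg₁ : HasCompactSupport (Complex.ofRealCLM ∘ g) := g_cpt.comp_left rfl
  have hg₂ : ContDiff ℝ (⊤ : ℕ∞) (Complex.ofRealCLM ∘ g) := by fun_prop
  have := h (hg₁.toSchwartzMap hg₂)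
  simpa using this

lemma sob_cont {u : R2 → ℂ} (hu : Integrable u) : Continuous (𝓕 u) :=
  VectorFourier.fourierIntegral_continuous Real.continuous_fourierChar continuous_inner hu

lemma sob_planch1 {u : R2 → ℂ} (hu : Integrable u) (h2 : MemLp u 2) :
    eLpNorm (𝓕 u) 2 = eLpNorm u 2 := by
  have key : ((𝓕 (h2.toLp u) : Lp ℂ 2 (volume : Measure R2)) : R2 → ℂ) =ᵐ[volume] 𝓕 u := by
    apply sob_ae_eq
    · exact (Lp.memLp _).locallyIntegrable (by norm_num)
    · exact (sob_cont hu).locallyIntegrable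
    · intro φ
      have := congrArg (fun T => T φ) (Lp.fourier_toTemperedDistribution_eq (h2.toLp u))
      simp only [TemperedDistribution.fourier_apply, Lp.toTemperedDistribution_apply,
        smul_eq_mul] at this
      rw [← this, sob_selfadj hu φ.integrable]
      apply integral_congr_ae
      filter_upwards [h2.coeFn_toLp] with x hx
      rw [hx, SchwartzMap.fourier_coe]
  rw [← eLpNorm_congr_ae key, ← Lp.enorm_def, ← ofReal_norm, Lp.norm_fourier_eq, ofReal_norm,
    Lp.enorm_def, eLpNorm_congr_ae h2.coeFn_toLp]

lemma sob_planch2 {u : R2 → ℂ} (hu : Integrable u) (h2 : MemLp (𝓕 u) 2) :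
    eLpNorm (𝓕 u) 2 = eLpNorm u 2 := by
  have key : ((𝓕⁻ (h2.toLp (𝓕 u)) : Lp ℂ 2 (volume : Measure R2)) : R2 → ℂ) =ᵐ[volume] u := by
    apply sob_ae_eq
    · exact (Lp.memLp _).locallyIntegrable (by norm_num)
    · exact hu.locallyIntegrable
    · intro φ
      have := congrArg (fun T => T φ) (Lp.fourierInv_toTemperedDistribution_eq (h2.toLp (𝓕 u)))
      simp only [TemperedDistribution.fourierInv_apply, Lp.toTemperedDistribution_apply,
        smul_eq_mul] at this
      rw [← this]
      trans ∫ x, (𝓕⁻ φ) x * 𝓕 u x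
      · apply integral_congr_ae
        filter_upwards [h2.coeFn_toLp] with x hx
        rw [hx]
      · rw [sob_selfadj hu (SchwartzMap.integrable _), ← SchwartzMap.fourier_coe]
        simp
  rw [← eLpNorm_congr_ae key, ← Lp.enorm_def, ← ofReal_norm, ← Lp.norm_fourier_eq,
    FourierTransform.fourier_fourierInv_eq, ofReal_norm,
    Lp.enorm_def, eLpNorm_congr_ae h2.coeFn_toLp]

lemma sob_planch {u : R2 → ℂ} (hu : Integrable u) :
    ∫⁻ ξ, ‖𝓕 u ξ‖ₑ ^ (2:ℝ) = ∫⁻ x, ‖u x‖ₑ ^ (2:ℝ) := by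
  have key : eLpNorm (𝓕 u) 2 = eLpNorm u 2 := by
    by_cases h : MemLp u 2
    · exact sob_planch1 hu h
    by_cases h' : MemLp (𝓕 u) 2
    · exact sob_planch2 hu h'
    have h1 : eLpNorm u 2 = ∞ := by
      by_contra hh
      exact h ⟨hu.1, Ne.lt_top hh⟩
    have h2 : eLpNorm (𝓕 u) 2 = ∞ := by
      by_contra hh
      exact h' ⟨(sob_cont hu).aestronglyMeasurable, Ne.lt_top hh⟩
    rw [h1, h2]
  rw [eLpNorm_eq_lintegral_rpow_enorm_toReal (by norm_num) (by norm_num),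
    eLpNorm_eq_lintegral_rpow_enorm_toReal (by norm_num) (by norm_num)] at key
  simp only [ENNReal.toReal_ofNat] at key
  exact ENNReal.rpow_left_injective (by norm_num) key

lemma sob_scale {r : ℝ} (hr : 0 < r) (φ : R2 → ℝ≥0∞) :
    ∫⁻ y, φ y = ENNReal.ofReal (r ^ 2) * ∫⁻ z, φ (r • z) := by
  have h1 := (Homeomorph.smulOfNeZero (α := R2) r hr.ne').measurableEmbedding.lintegral_map
    (μ := volume) φ
  have h2 : Measure.map (⇑(Homeomorph.smulOfNeZero (α := R2) r hr.ne')) volume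
      = ENNReal.ofReal |(r ^ 2)⁻¹| • (volume : Measure R2) := by
    have := Measure.map_addHaar_smul (volume : Measure R2) hr.ne'
    rw [finrank_euclideanSpace_fin] at this
    exact this
  rw [h2, lintegral_smul_measure] at h1
  have h3 : ∫⁻ z, φ (r • z) = ENNReal.ofReal |(r ^ 2)⁻¹| * ∫⁻ y, φ y := h1.symm
  rw [h3, ← mul_assoc, ← ENNReal.ofReal_mul (by positivity), abs_of_pos (by positivity),
    mul_inv_cancel₀ (by positivity)]
  simp

lemma sob_enorm_smul {r : ℝ} (hr : 0 < r) (z : R2) : ‖r • z‖ₑ = ENNReal.ofReal r * ‖z‖ₑ := by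
  rw [enorm_smul, Real.enorm_of_nonneg hr.le]

lemma sob_ofReal_rpow {r : ℝ} (hr : 0 < r) (n : ℝ) :
    ENNReal.ofReal r ^ n = ENNReal.ofReal (r ^ n) := ENNReal.ofReal_rpow_of_pos hr

def sobA (γ : ℝ) : ℝ≥0∞ := ∫⁻ y : R2, if ‖y‖ ≤ 2 then ‖y‖ₑ ^ (-2 * γ) else 0

lemma sobA_scale (γ : ℝ) {x : R2} (hx : x ≠ 0) :
    ∫⁻ y : R2, (if ‖y‖ ≤ 2 * ‖x‖ then ‖y‖ₑ ^ (-2 * γ) else 0) = ‖x‖ₑ ^ (2 - 2 * γ) * sobA γ := by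
  have hr : 0 < ‖x‖ := norm_pos_iff.mpr hx
  rw [sob_scale hr, sobA]
  have : ∀ z : R2, (if ‖‖x‖ • z‖ ≤ 2 * ‖x‖ then ‖‖x‖ • z‖ₑ ^ (-2 * γ) else 0)
      = ENNReal.ofReal (‖x‖ ^ (-2 * γ)) * (if ‖z‖ ≤ 2 then ‖z‖ₑ ^ (-2 * γ) else 0) := by
    intro z
    have h1 : ‖‖x‖ • z‖ ≤ 2 * ‖x‖ ↔ ‖z‖ ≤ 2 := by
      rw [norm_smul, norm_norm, mul_comm]
      exact mul_le_mul_iff_left₀ hr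
    simp only [h1]
    split_ifs
    · rw [sob_enorm_smul hr, ENNReal.mul_rpow_of_ne_top (by simp) (by simp), sob_ofReal_rpow hr]
    · simp
  simp_rw [this]
  rw [lintegral_const_mul' _ _ (by simp), ← mul_assoc, ← ENNReal.ofReal_mul (by positivity),
    ← Real.rpow_natCast, ← Real.rpow_add hr, ← ofReal_norm, sob_ofReal_rpow hr]
  congr 3
  push_cast; ring_nf

lemma sob_ae_ne (x : R2) : ∀ᵐ y : R2, y ≠ x := by
  have : (volume : Measure R2) {x} = 0 := measure_singleton x
  rw [ae_iff]; simp

lemma sobA_lt_top {γ : ℝ} (hγ : γ < 1) : sobA γ < ∞ := by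
  have h := integrableOn_ball_of_norm_le_rpow (μ := (volume : Measure R2)) (E := R2)
    (f := fun x : R2 => ‖x‖ ^ (-2 * γ)) (C := 1) (α := 2 * γ) (r := 3)
    (by simp) (by simp; linarith)
    (Filter.Eventually.of_forall fun x => by
      rw [Real.norm_of_nonneg (by positivity)]; simp)
    (by apply Measurable.aestronglyMeasurable; fun_prop)
  have h2 := h.2
  rw [HasFiniteIntegral] at h2
  refine lt_of_le_of_lt ?_ h2
  rw [← lintegral_indicator measurableSet_ball, sobA]
  apply lintegral_mono_ae
  filter_upwards [sob_ae_ne 0] with y hy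
  have hr : 0 < ‖y‖ := norm_pos_iff.mpr hy
  split_ifs with h
  · rw [Set.indicator_of_mem (by simp; linarith), Real.enorm_of_nonneg (by positivity),
      ← ofReal_norm, sob_ofReal_rpow hr]
  · simp

def sobW (b : ℝ) (ξ : R2) : ℝ≥0∞ :=
  ∫⁻ h : R2, ‖h‖ₑ ^ (-2 - 2 * b) * ‖((𝐞 (inner ℝ h ξ) : Circle) : ℂ) - 1‖ₑ ^ (2:ℝ)

abbrev sobE : R2 := EuclideanSpace.single 0 1

lemma sobW_rot (b : ℝ) {v w : R2} (h : ‖v‖ = ‖w‖) : sobW b v = sobW b w := by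
  set R := (Submodule.span ℝ {v - w})ᗮ.reflection with hR
  have hv : R v = w := Submodule.reflection_sub h
  have hm : MeasurePreserving R volume volume := R.measurePreserving
  unfold sobW
  rw [← hm.lintegral_comp_emb R.toHomeomorph.measurableEmbedding
    (fun h => ‖h‖ₑ ^ (-2 - 2 * b) * ‖((𝐞 (inner ℝ h w) : Circle) : ℂ) - 1‖ₑ ^ (2:ℝ))]
  congr with x
  rw [← hv, R.inner_map_map, R.enorm_map]

lemma sobW_eq (b : ℝ) {ξ : R2} (hξ : ξ ≠ 0) : sobW b ξ = ‖ξ‖ₑ ^ (2 * b) * sobW b sobE := by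
  have hr : 0 < ‖ξ‖ := norm_pos_iff.mpr hξ
  rw [← sobW_rot b (v := ‖ξ‖⁻¹ • ξ) (w := sobE) (by simp [norm_smul, hr.ne'])]
  unfold sobW
  rw [sob_scale (inv_pos.mpr hr)]
  have : ∀ z : R2, ‖‖ξ‖⁻¹ • z‖ₑ ^ (-2 - 2 * b)
        * ‖((𝐞 (inner ℝ (‖ξ‖⁻¹ • z) ξ) : Circle) : ℂ) - 1‖ₑ ^ (2:ℝ)
      = ENNReal.ofReal (‖ξ‖⁻¹ ^ (-2 - 2 * b)) * (‖z‖ₑ ^ (-2 - 2 * b)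
        * ‖((𝐞 (inner ℝ z (‖ξ‖⁻¹ • ξ)) : Circle) : ℂ) - 1‖ₑ ^ (2:ℝ)) := by
    intro z
    rw [sob_enorm_smul (inv_pos.mpr hr), ENNReal.mul_rpow_of_ne_top (by simp) (by simp),
      sob_ofReal_rpow (inv_pos.mpr hr), real_inner_smul_left, real_inner_smul_right, mul_assoc]
  simp_rw [this]
  rw [lintegral_const_mul' _ _ (by simp), ← mul_assoc, ← ENNReal.ofReal_mul (by positivity),
    ← Real.rpow_natCast, ← Real.rpow_add (inv_pos.mpr hr), ← ofReal_norm, sob_ofReal_rpow hr,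
    Real.inv_rpow hr.le, ← Real.rpow_neg hr.le]
  congr 3
  push_cast; ring_nf

lemma sob_char_le (θ : ℝ) : ‖((𝐞 θ : Circle) : ℂ) - 1‖ ≤ 2 * π * |θ| := by
  have := Real.norm_exp_I_mul_ofReal_sub_one_le (x := 2 * π * θ)
  rw [Real.fourierChar_apply, mul_comm]
  refine this.trans (le_of_eq ?_)
  rw [Real.norm_eq_abs, abs_mul, abs_of_pos (by positivity)]

lemma sob_char_le' (θ : ℝ) : ‖((𝐞 θ : Circle) : ℂ) - 1‖ ≤ 2 := by
  refine (norm_sub_le _ _).trans ?_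
  rw [Circle.norm_coe, norm_one]; norm_num

lemma sobW_lt_top {b : ℝ} (hb0 : 0 < b) (hb1 : b < 1) : sobW b sobE < ∞ := by
  have hA := sobA_lt_top hb1
  have hB := finite_integral_one_add_norm (E := R2) (μ := volume) (r := 2 + 2 * b)
    (by simp; linarith)
  have hle : sobW b sobE ≤ ∫⁻ h : R2, (ENNReal.ofReal ((2 * π) ^ 2)
      * (if ‖h‖ ≤ 2 then ‖h‖ₑ ^ (-2 * b) else 0)
      + ENNReal.ofReal (4 * 2 ^ (2 + 2 * b)) * ENNReal.ofReal ((1 + ‖h‖) ^ (-(2 + 2 * b)))) := by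
    apply lintegral_mono_ae
    filter_upwards [sob_ae_ne 0] with h hh
    have hr : 0 < ‖h‖ := norm_pos_iff.mpr hh
    have e1 : ‖h‖ₑ ^ (-2 - 2 * b) * ‖((𝐞 (inner ℝ h sobE) : Circle) : ℂ) - 1‖ₑ ^ (2:ℝ)
      = ENNReal.ofReal (‖h‖ ^ (-2 - 2 * b) * ‖((𝐞 (inner ℝ h sobE) : Circle) : ℂ) - 1‖ ^ 2) := by
      rw [← ofReal_norm, ← ofReal_norm, sob_ofReal_rpow hr, ENNReal.ofReal_mul (by positivity),
        ENNReal.ofReal_rpow_of_nonneg (by positivity) (by positivity)]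
      norm_num
    rw [e1]
    by_cases h2 : ‖h‖ ≤ 2
    · refine le_trans ?_ le_self_add
      rw [if_pos h2, ← ofReal_norm, sob_ofReal_rpow hr, ← ENNReal.ofReal_mul (by positivity)]
      apply ENNReal.ofReal_le_ofReal
      have h3 : ‖((𝐞 (inner ℝ h sobE) : Circle) : ℂ) - 1‖ ≤ 2 * π * ‖h‖ := by
        refine (sob_char_le _).trans ?_
        gcongr
        refine (abs_real_inner_le_norm _ _).trans ?_
        simp
      calc _ ≤ ‖h‖ ^ (-2 - 2 * b) * (2 * π * ‖h‖) ^ 2 := by gcongr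
        _ = (2 * π) ^ 2 * (‖h‖ ^ (-2 - 2 * b) * ‖h‖ ^ (2:ℝ)) := by norm_num; ring
        _ = _ := by rw [← Real.rpow_add hr]; ring_nf
    · refine le_trans ?_ le_add_self
      push Not at h2
      rw [← ENNReal.ofReal_mul (by positivity)]
      apply ENNReal.ofReal_le_ofReal
      have h3 := sob_char_le' (inner ℝ h sobE)
      calc _ ≤ ‖h‖ ^ (-2 - 2 * b) * 2 ^ 2 := by gcongr
        _ ≤ ((1 + ‖h‖) / 2) ^ (-2 - 2 * b) * 2 ^ 2 := by
            gcongr ?_ * _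
            apply Real.rpow_le_rpow_of_nonpos (by positivity) (by linarith) (by linarith)
        _ = _ := by
            rw [Real.div_rpow (by positivity) (by positivity), div_eq_mul_inv,
              ← Real.rpow_neg (by positivity)]
            ring_nf
  refine lt_of_le_of_lt hle ?_
  rw [lintegral_add_right _ (by fun_prop), lintegral_const_mul' _ _ ENNReal.ofReal_ne_top,
    lintegral_const_mul' _ _ ENNReal.ofReal_ne_top]
  exact ENNReal.add_lt_top.mpr ⟨ENNReal.mul_lt_top ENNReal.ofReal_lt_top hA,
    ENNReal.mul_lt_top ENNReal.ofReal_lt_top hB⟩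

lemma sobW_pos (b : ℝ) : sobW b sobE ≠ 0 := by
  intro h0
  unfold sobW at h0
  rw [lintegral_eq_zero_iff (by fun_prop)] at h0
  have hopen : IsOpen {h : R2 | ((𝐞 (inner ℝ h sobE) : Circle) : ℂ) ≠ 1} := by
    have : Continuous fun h : R2 => ((𝐞 (inner ℝ h sobE) : Circle) : ℂ) := by
      have := Real.continuous_fourierChar
      fun_prop
    exact isOpen_ne_fun this continuous_const
  have hne : {h : R2 | ((𝐞 (inner ℝ h sobE) : Circle) : ℂ) ≠ 1}.Nonempty := by
    refine ⟨(1/2 : ℝ) • sobE, ?_⟩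
    simp only [Set.mem_ofPred_eq, real_inner_smul_left, real_inner_self_eq_norm_sq]
    rw [Real.fourierChar_apply]
    have : (((2 * π * (1 / 2 * ‖sobE‖ ^ 2) : ℝ) : ℂ) * Complex.I) = π * Complex.I := by
      simp; ring
    rw [this, Complex.exp_pi_mul_I]
    norm_num
  refine (hopen.measure_pos volume hne).ne' ?_
  refine measure_mono_null ?_ h0
  intro h hh
  simp only [Set.mem_ofPred_eq] at hh
  simp only [Set.mem_compl_iff, Set.mem_ofPred_eq, Pi.zero_apply, mul_eq_zero, not_or]
  constructor
  · have : h ≠ 0 := by rintro rfl; simp at hh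
    simp [ENNReal.rpow_eq_zero_iff, this]
  · simp [sub_eq_zero, hh]

lemma sob_fourier_diff {g : R2 → ℂ} (hg : Integrable g) (h ξ : R2) :
    𝓕 (fun x => g (x + h) - g x) ξ = (((𝐞 (inner ℝ h ξ) : Circle) : ℂ) - 1) * 𝓕 g ξ := by
  have h1 : 𝓕 (g ∘ fun v ↦ v + h) ξ = 𝐞 (inner ℝ h ξ) • 𝓕 g ξ :=
    congrFun (VectorFourier.fourierIntegral_comp_add_right 𝐞 volume (innerₗ R2) g h) ξ
  have h2 : 𝓕 (fun x => g (x + h) - g x) ξ = 𝓕 (g ∘ fun v ↦ v + h) ξ - 𝓕 g ξ := by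
    simp only [Real.fourier_eq, smul_sub]
    rw [integral_sub]
    · rfl
    · exact (Real.fourierIntegral_convergent_iff ξ).2 (hg.comp_add_right h)
    · exact (Real.fourierIntegral_convergent_iff ξ).2 hg
  rw [h2, h1, Circle.smul_def, smul_eq_mul]; ring

def sobK (p : R2 × R2) : ℝ≥0∞ := ‖((𝐞 (inner ℝ p.1 p.2) : Circle) : ℂ) - 1‖ₑ ^ (2:ℝ)

lemma sobK_meas : Measurable sobK := by
  have hc : Continuous (fun p : R2 × R2 => ((𝐞 (inner ℝ p.1 p.2) : Circle) : ℂ)) := by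
    have := Real.continuous_fourierChar
    fun_prop
  have hcm := hc.measurable
  unfold sobK
  exact ((hcm.sub_const 1).enorm).pow_const _

lemma sob_diff_norm {g : R2 → ℂ} (hg : Integrable g) (h : R2) :
    ∫⁻ x, ‖g (x + h) - g x‖ₑ ^ (2:ℝ) = ∫⁻ ξ, sobK (h, ξ) * ‖𝓕 g ξ‖ₑ ^ (2:ℝ) := by
  have hi : Integrable (fun x => g (x + h) - g x) := (hg.comp_add_right h).sub hg
  rw [← sob_planch hi]
  congr with ξ
  rw [sob_fourier_diff hg h ξ, enorm_mul, ENNReal.mul_rpow_of_nonneg _ _ (by norm_num)]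
  rfl

lemma sob_gag {b : ℝ} {g : R2 → ℂ} (hg : Integrable g) :
    ∫⁻ h : R2, ‖h‖ₑ ^ (-2 - 2 * b) * ∫⁻ x, ‖g (x + h) - g x‖ₑ ^ (2:ℝ)
      = sobW b sobE * hSobSq b g := by
  have hm : Measurable (𝓕 g) := (sob_cont hg).measurable
  have hK := sobK_meas
  have hK1 : ∀ h, Measurable fun ξ => sobK (h, ξ) := fun h => hK.comp measurable_prodMk_left
  have hK2 : ∀ ξ, Measurable fun h => sobK (h, ξ) := fun h => hK.comp measurable_prodMk_right
  have e1 : ∀ h : R2, ‖h‖ₑ ^ (-2 - 2 * b) * ∫⁻ x, ‖g (x + h) - g x‖ₑ ^ (2:ℝ)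
      = ∫⁻ ξ, ‖h‖ₑ ^ (-2 - 2 * b) * sobK (h, ξ) * ‖𝓕 g ξ‖ₑ ^ (2:ℝ) := by
    intro h
    rw [sob_diff_norm hg, ← lintegral_const_mul]
    · simp_rw [mul_assoc]
    · exact (hK1 h).mul (hm.enorm.pow_const _)
  simp_rw [e1]
  rw [lintegral_lintegral_swap]
  · unfold hSobSq
    rw [← lintegral_const_mul]
    · apply lintegral_congr_ae
      filter_upwards [sob_ae_ne 0] with ξ hξ
      rw [lintegral_mul_const]
      · change sobW b ξ * _ = _
        rw [sobW_eq b hξ]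
        simp only [enorm_eq_nnnorm]
        ring
      · exact (measurable_enorm.pow_const _).mul (hK2 ξ)
    · exact (measurable_enorm.pow_const _).mul (hm.enorm.pow_const _)
  · apply Measurable.aemeasurable
    exact ((measurable_enorm.comp measurable_fst).pow_const _ |>.mul hK).mul
      ((hm.comp measurable_snd).enorm.pow_const _)

lemma sob_lip {b : ℝ} (hb0 : 0 < b) (hb1 : b < 1) {g : R2 → ℂ} (hg : Integrable g) {T : ℂ → ℂ}
    (hT : ∀ z w, ‖T z - T w‖ ≤ ‖z - w‖) (hTg : Integrable (fun x => T (g x))) :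
    hSobSq b (fun x => T (g x)) ≤ hSobSq b g := by
  have h : ∫⁻ h : R2, ‖h‖ₑ ^ (-2 - 2 * b) * ∫⁻ x, ‖T (g (x + h)) - T (g x)‖ₑ ^ (2:ℝ)
      ≤ ∫⁻ h : R2, ‖h‖ₑ ^ (-2 - 2 * b) * ∫⁻ x, ‖g (x + h) - g x‖ₑ ^ (2:ℝ) := by
    gcongr with h x
    exact enorm_le_iff_norm_le.2 (hT _ _)
  rw [sob_gag (b := b) hTg] at h
  rw [sob_gag hg] at h
  exact (ENNReal.mul_le_mul_iff_right (sobW_pos b) (sobW_lt_top hb0 hb1).ne).1 h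

def sobClamp (n x : ℝ) : ℝ := max (-n) (min x n)

lemma sobClamp_lip (n x y : ℝ) : |sobClamp n x - sobClamp n y| ≤ |x - y| := by
  unfold sobClamp
  refine (abs_max_sub_max_le_max _ _ _ _).trans ?_
  simp only [sub_self, abs_zero]
  refine max_le (abs_nonneg _) ?_
  refine (abs_min_sub_min_le_max _ _ _ _).trans ?_
  simp

lemma sobClamp_zero {n : ℝ} (hn : 0 ≤ n) : sobClamp n 0 = 0 := by
  simp [sobClamp, hn]

lemma sobClamp_le {n : ℝ} (hn : 0 ≤ n) (x : ℝ) : |sobClamp n x| ≤ n := by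
  unfold sobClamp
  rw [abs_le]
  exact ⟨le_max_left _ _, max_le (by linarith) (min_le_right _ _)⟩

lemma sobClamp_eq {n x : ℝ} (h : |x| ≤ n) : sobClamp n x = x := by
  unfold sobClamp
  rw [abs_le] at h
  rw [min_eq_left h.2, max_eq_right h.1]

def sobT (n : ℝ) (z : ℂ) : ℂ := ⟨sobClamp n z.re, sobClamp n z.im⟩

lemma sobT_lip (n : ℝ) (z w : ℂ) : ‖sobT n z - sobT n w‖ ≤ ‖z - w‖ := by
  rw [← sq_le_sq₀ (norm_nonneg _) (norm_nonneg _), Complex.sq_norm, Complex.sq_norm,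
    Complex.normSq_apply, Complex.normSq_apply]
  simp only [sobT, Complex.sub_re, Complex.sub_im]
  have h1 := sq_le_sq.2 (sobClamp_lip n z.re w.re)
  have h2 := sq_le_sq.2 (sobClamp_lip n z.im w.im)
  nlinarith

lemma sobT_zero {n : ℝ} (hn : 0 ≤ n) : sobT n 0 = 0 := by
  simp [sobT, sobClamp_zero hn]; rfl

lemma sobT_le {n : ℝ} (hn : 0 ≤ n) (z : ℂ) : ‖sobT n z‖ ≤ ‖z‖ := by
  simpa [sobT_zero hn] using sobT_lip n z 0

lemma sobT_le' {n : ℝ} (hn : 0 ≤ n) (z : ℂ) : ‖sobT n z‖ ≤ 2 * n := by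
  refine (Complex.norm_le_abs_re_add_abs_im _).trans ?_
  have h1 := sobClamp_le hn z.re
  have h2 := sobClamp_le hn z.im
  simp only [sobT]
  linarith

lemma sobT_eq {n : ℝ} {z : ℂ} (h : ‖z‖ ≤ n) : sobT n z = z := by
  apply Complex.ext
  · exact sobClamp_eq ((Complex.abs_re_le_norm z).trans h)
  · exact sobClamp_eq ((Complex.abs_im_le_norm z).trans h)

lemma sobT_cont (n : ℝ) : Continuous (sobT n) := by
  have : LipschitzWith 1 (sobT n) := LipschitzWith.of_dist_le_mul fun z w => by
    simpa [dist_eq_norm] using sobT_lip n z w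
  exact this.continuous

lemma sob_fatou {s : ℝ} {u : ℕ → R2 → ℂ} {v : R2 → ℂ} {B : R2 → ℝ} (hB : Integrable B)
    (hu : ∀ n, AEStronglyMeasurable (u n)) (hv : Integrable v) (hle : ∀ n, ∀ᵐ x, ‖u n x‖ ≤ B x)
    (hlim : ∀ᵐ x, Filter.Tendsto (fun n => u n x) Filter.atTop (nhds (v x))) {K : ℝ≥0∞}
    (hK : ∀ n, hSobSq s (u n) ≤ K) : hSobSq s v ≤ K := by
  have hui : ∀ n, Integrable (u n) := fun n => hB.mono' (hu n) (hle n)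
  have hpt : ∀ ξ, Filter.Tendsto (fun n => 𝓕 (u n) ξ) Filter.atTop (nhds (𝓕 v ξ)) := by
    intro ξ
    simp only [Real.fourier_eq]
    apply tendsto_integral_of_dominated_convergence B
    · intro n
      exact ((Real.fourierIntegral_convergent_iff ξ).2 (hui n)).1
    · exact hB
    · intro n
      filter_upwards [hle n] with x hx
      rwa [Circle.norm_smul]
    · filter_upwards [hlim] with x hx
      exact hx.const_smul _
  have hfat := lintegral_liminf_le (μ := (volume : Measure R2)) (u := Filter.atTop)
    (f := fun (n : ℕ) ξ => (‖ξ‖₊ : ℝ≥0∞) ^ (2 * s) * (‖𝓕 (u n) ξ‖₊ : ℝ≥0∞) ^ (2 : ℝ))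
    (fun n => by
      have hm : Measurable (𝓕 (u n)) := (sob_cont (hui n)).measurable
      fun_prop)
  have h1 : hSobSq s v ≤ ∫⁻ ξ : R2, Filter.liminf (fun n =>
      (‖ξ‖₊ : ℝ≥0∞) ^ (2 * s) * (‖𝓕 (u n) ξ‖₊ : ℝ≥0∞) ^ (2 : ℝ)) Filter.atTop := by
    apply lintegral_mono_ae
    filter_upwards [sob_ae_ne 0] with ξ hξ
    apply le_of_eq
    symm
    apply Filter.Tendsto.liminf_eq
    apply ENNReal.Tendsto.const_mul
    · have := (hpt ξ).enorm
      exact (ENNReal.continuous_rpow_const.tendsto _).comp this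
    · right
      simp [ENNReal.rpow_eq_top_iff, hξ]
  refine h1.trans (hfat.trans ?_)
  refine Filter.liminf_le_of_le (by isBoundedDefault) ?_
  intro c hc
  obtain ⟨n, hn⟩ := hc.exists
  exact hn.trans (hK n)

lemma sob_rpow_comp {a x z : ℝ} (ha : -1 < a) (ha' : a < 1) (hx : 0 < x) (hz : 0 < z)
    (h1 : z ≤ 3 * x) (h2 : x ≤ 3 * z) : z ^ (-a) ≤ 3 * x ^ (-a) := by
  have key : (z / x) ^ (-a) ≤ 3 := by
    rcases le_total 0 a with h | h
    · rw [Real.rpow_neg (by positivity), ← Real.inv_rpow (by positivity), inv_div]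
      calc (x / z) ^ a ≤ 3 ^ a := by
            gcongr
            rw [div_le_iff₀ hz]; exact h2
        _ ≤ 3 ^ (1:ℝ) := Real.rpow_le_rpow_of_exponent_le (by norm_num) ha'.le
        _ = 3 := by simp
    · calc (z / x) ^ (-a) ≤ 3 ^ (-a) := by
            apply Real.rpow_le_rpow (by positivity) _ (by linarith)
            rw [div_le_iff₀ hx]; exact h1
        _ ≤ 3 ^ (1:ℝ) := Real.rpow_le_rpow_of_exponent_le (by norm_num) (by linarith)
        _ = 3 := by simp
  rwa [Real.div_rpow hz.le hx.le, div_le_iff₀ (by positivity)] at key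

def sobker (γ : ℝ) (x y : R2) : ℝ≥0∞ :=
  if ‖y‖ ≤ 2 * ‖x‖ then ‖x‖ₑ ^ (γ - 1) * ‖y‖ₑ ^ (-γ) else 0

lemma sobker_meas (γ : ℝ) : Measurable (fun p : R2 × R2 => sobker γ p.1 p.2) := by
  unfold sobker
  apply Measurable.ite
  · exact measurableSet_le (by fun_prop) (by fun_prop)
  · fun_prop
  · fun_prop

lemma sobker_eq (γ : ℝ) {x y : R2} (hx : x ≠ 0) (hy : y ≠ 0) (h : ‖y‖ ≤ 2 * ‖x‖) :
    sobker γ x y = ENNReal.ofReal (‖x‖ ^ (γ - 1) * ‖y‖ ^ (-γ)) := by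
  have h1 : 0 < ‖x‖ := norm_pos_iff.mpr hx
  have h2 : 0 < ‖y‖ := norm_pos_iff.mpr hy
  rw [sobker, if_pos h, ← ofReal_norm, ← ofReal_norm, sob_ofReal_rpow h1, sob_ofReal_rpow h2,
    ENNReal.ofReal_mul (by positivity)]

lemma sobker_int (γ : ℝ) {x : R2} (hx : x ≠ 0) :
    ∫⁻ y, sobker γ x y ^ (2:ℝ) = sobA γ := by
  have hr : 0 < ‖x‖ := norm_pos_iff.mpr hx
  have e : ∀ y : R2, sobker γ x y ^ (2:ℝ) = ENNReal.ofReal (‖x‖ ^ (2 * γ - 2)) *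
      (if ‖y‖ ≤ 2 * ‖x‖ then ‖y‖ₑ ^ (-2 * γ) else 0) := by
    intro y
    unfold sobker
    split_ifs
    · rw [ENNReal.mul_rpow_of_nonneg _ _ (by norm_num), ← ENNReal.rpow_mul, ← ENNReal.rpow_mul,
        ← ofReal_norm x, sob_ofReal_rpow hr]
      congr 2 <;> ring_nf
    · simp
  simp_rw [e]
  rw [lintegral_const_mul' _ _ ENNReal.ofReal_ne_top, sobA_scale γ hx, ← ofReal_norm,
    sob_ofReal_rpow hr, ← mul_assoc, ← ENNReal.ofReal_mul (by positivity), ← Real.rpow_add hr]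
  ring_nf
  simp

lemma sob_kernel {a b : ℝ} (ha : -1 < a) (ha' : a < 1) (hb : -1 < b) (hb' : b < 1) {ξ η : R2}
    (h1 : ξ ≠ 0) (h2 : η ≠ 0) (h3 : ξ - η ≠ 0) :
    ‖ξ‖ₑ ^ (a + b - 1) * (‖ξ - η‖ₑ ^ (-a) * ‖η‖ₑ ^ (-b)) ≤
      3 * (sobker b ξ η + sobker a ξ (ξ - η) + sobker (1 - (a + b)) η ξ) := by
  have hx : 0 < ‖ξ‖ := norm_pos_iff.mpr h1
  have hy : 0 < ‖η‖ := norm_pos_iff.mpr h2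
  have hz : 0 < ‖ξ - η‖ := norm_pos_iff.mpr h3
  have t1 : ‖ξ - η‖ ≤ ‖ξ‖ + ‖η‖ := norm_sub_le _ _
  have t2 : ‖ξ‖ ≤ ‖ξ - η‖ + ‖η‖ := by simpa using norm_add_le (ξ - η) η
  have t3 : ‖η‖ ≤ ‖ξ‖ + ‖ξ - η‖ := by simpa using norm_sub_le ξ (ξ - η)
  have e : ‖ξ‖ₑ ^ (a + b - 1) * (‖ξ - η‖ₑ ^ (-a) * ‖η‖ₑ ^ (-b)) = ENNReal.ofReal
      (‖ξ‖ ^ (a + b - 1) * (‖ξ - η‖ ^ (-a) * ‖η‖ ^ (-b))) := by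
    rw [← ofReal_norm, ← ofReal_norm, ← ofReal_norm, sob_ofReal_rpow hx, sob_ofReal_rpow hy,
      sob_ofReal_rpow hz, ENNReal.ofReal_mul (by positivity), ENNReal.ofReal_mul (by positivity)]
  rw [e]
  have h30 : (3 : ℝ≥0∞) = ENNReal.ofReal 3 := by norm_num
  by_cases c1 : 2 * ‖η‖ ≤ ‖ξ‖
  · calc _ ≤ 3 * sobker b ξ η := by
          rw [sobker_eq b h1 h2 (by linarith), h30, ← ENNReal.ofReal_mul (by norm_num)]
          apply ENNReal.ofReal_le_ofReal
          have := sob_rpow_comp ha ha' hx hz (by linarith) (by linarith)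
          calc _ ≤ ‖ξ‖ ^ (a + b - 1) * ((3 * ‖ξ‖ ^ (-a)) * ‖η‖ ^ (-b)) := by gcongr
            _ = 3 * ((‖ξ‖ ^ (a + b - 1) * ‖ξ‖ ^ (-a)) * ‖η‖ ^ (-b)) := by ring
            _ = _ := by rw [← Real.rpow_add hx]; ring_nf
      _ ≤ _ := by
          gcongr
          rw [add_assoc]; exact le_self_add
  by_cases c2 : 2 * ‖ξ - η‖ ≤ ‖ξ‖
  · calc _ ≤ 3 * sobker a ξ (ξ - η) := by
          rw [sobker_eq a h1 h3 (by linarith), h30, ← ENNReal.ofReal_mul (by norm_num)]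
          apply ENNReal.ofReal_le_ofReal
          have := sob_rpow_comp hb hb' hx hy (by linarith) (by linarith)
          calc _ ≤ ‖ξ‖ ^ (a + b - 1) * (‖ξ - η‖ ^ (-a) * (3 * ‖ξ‖ ^ (-b))) := by gcongr
            _ = 3 * ((‖ξ‖ ^ (a + b - 1) * ‖ξ‖ ^ (-b)) * ‖ξ - η‖ ^ (-a)) := by ring
            _ = _ := by rw [← Real.rpow_add hx]; ring_nf
      _ ≤ _ := by
          gcongr
          exact le_add_self.trans le_self_add
  · push Not at c1 c2
    calc _ ≤ 3 * sobker (1 - (a + b)) η ξ := by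
          rw [sobker_eq _ h2 h1 (by linarith), h30, ← ENNReal.ofReal_mul (by norm_num)]
          apply ENNReal.ofReal_le_ofReal
          have := sob_rpow_comp ha ha' hy hz (by linarith) (by linarith)
          calc _ ≤ ‖ξ‖ ^ (a + b - 1) * ((3 * ‖η‖ ^ (-a)) * ‖η‖ ^ (-b)) := by gcongr
            _ = 3 * ((‖η‖ ^ (-a) * ‖η‖ ^ (-b)) * ‖ξ‖ ^ (a + b - 1)) := by ring
            _ = _ := by rw [← Real.rpow_add hy]; ring_nf
      _ ≤ _ := by
          gcongr
          exact le_add_self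

lemma sob_cs {P Q : R2 × R2 → ℝ≥0∞} (hP : Measurable P) (hQ : Measurable Q) :
    ∫⁻ x, ∫⁻ y, P (x, y) * Q (x, y) ≤ (∫⁻ x, ∫⁻ y, P (x, y) ^ (2:ℝ)) ^ (1 / 2 : ℝ) *
      (∫⁻ x, ∫⁻ y, Q (x, y) ^ (2:ℝ)) ^ (1 / 2 : ℝ) := by
  have h := ENNReal.lintegral_mul_le_Lp_mul_Lq ((volume : Measure R2).prod (volume : Measure R2))
    Real.HolderConjugate.two_two hP.aemeasurable hQ.aemeasurable
  rw [lintegral_prod _ (hP.mul hQ).aemeasurable, lintegral_prod _ (hP.pow_const _).aemeasurable,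
    lintegral_prod _ (hQ.pow_const _).aemeasurable] at h
  exact h

attribute [irreducible] sobker sobA

section tri

variable {H F G : R2 → ℝ≥0∞}

lemma sob_conv_sq (hF : Measurable F) (hG : Measurable G) :
    ∫⁻ x, ∫⁻ y, (F (x - y) * G y) ^ (2:ℝ) = (∫⁻ x, F x ^ (2:ℝ)) * ∫⁻ x, G x ^ (2:ℝ) := by
  rw [lintegral_lintegral_swap]
  · simp_rw [ENNReal.mul_rpow_of_nonneg _ _ (show (0:ℝ) ≤ 2 by norm_num)]
    have : ∀ y, ∫⁻ x, F (x - y) ^ (2:ℝ) * G y ^ (2:ℝ) = (∫⁻ x, F x ^ (2:ℝ)) * G y ^ (2:ℝ) := by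
      intro y
      rw [lintegral_mul_const _ (by fun_prop), lintegral_sub_right_eq_self (fun x => F x ^ (2:ℝ)) y]
    simp_rw [this]
    rw [lintegral_const_mul _ (by fun_prop)]
  · apply Measurable.aemeasurable
    unfold Function.uncurry
    simp only
    fun_prop

lemma sob_conv_sq' (hF : Measurable F) (hH : Measurable H) :
    ∫⁻ x, ∫⁻ y, (H x * F (x - y)) ^ (2:ℝ) = (∫⁻ x, H x ^ (2:ℝ)) * ∫⁻ x, F x ^ (2:ℝ) := by
  simp_rw [ENNReal.mul_rpow_of_nonneg _ _ (show (0:ℝ) ≤ 2 by norm_num)]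
  have : ∀ x, ∫⁻ y, H x ^ (2:ℝ) * F (x - y) ^ (2:ℝ) = H x ^ (2:ℝ) * ∫⁻ x, F x ^ (2:ℝ) := by
    intro x
    rw [lintegral_const_mul _ (by fun_prop), lintegral_sub_left_eq_self (fun x => F x ^ (2:ℝ)) x]
  simp_rw [this]
  rw [lintegral_mul_const _ (by fun_prop)]

lemma sob_ker_sq (γ : ℝ) (hH : Measurable H) :
    ∫⁻ x, ∫⁻ y, (H x * sobker γ x y) ^ (2:ℝ) = (∫⁻ x, H x ^ (2:ℝ)) * sobA γ := by
  rw [← lintegral_mul_const _ (hH.pow_const _)]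
  apply lintegral_congr_ae
  filter_upwards [sob_ae_ne 0] with x hx
  have hm : Measurable fun y => sobker γ x y := (sobker_meas γ).comp measurable_prodMk_left
  simp_rw [ENNReal.mul_rpow_of_nonneg _ _ (show (0:ℝ) ≤ 2 by norm_num)]
  rw [lintegral_const_mul _ (hm.pow_const _), sobker_int γ hx]

lemma sob_ker_sq2 (γ : ℝ) (hH : Measurable H) :
    ∫⁻ x, ∫⁻ y, (H x * sobker γ x (x - y)) ^ (2:ℝ) = (∫⁻ x, H x ^ (2:ℝ)) * sobA γ := by
  rw [← sob_ker_sq γ hH]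
  congr with x
  exact lintegral_sub_left_eq_self (fun y => (H x * sobker γ x y) ^ (2:ℝ)) x

lemma sob_ker_sq3 (γ : ℝ) (hG : Measurable G) :
    ∫⁻ x, ∫⁻ y, (G y * sobker γ y x) ^ (2:ℝ) = (∫⁻ x, G x ^ (2:ℝ)) * sobA γ := by
  rw [← sob_ker_sq γ hG, lintegral_lintegral_swap]
  apply Measurable.aemeasurable
  exact ((hG.comp measurable_snd).mul ((sobker_meas γ).comp measurable_swap)).pow_const _

def sobC (a b : ℝ) : ℝ≥0∞ := 3 * (sobA b ^ (1 / 2 : ℝ) + sobA a ^ (1 / 2 : ℝ)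
  + sobA (1 - (a + b)) ^ (1 / 2 : ℝ))

lemma sobC_lt_top {a b : ℝ} (ha : a < 1) (hb : b < 1) (hab : 0 < a + b) : sobC a b < ∞ := by
  have h1 := sobA_lt_top ha
  have h2 := sobA_lt_top hb
  have h3 := sobA_lt_top (γ := 1 - (a + b)) (by linarith)
  unfold sobC
  apply ENNReal.mul_lt_top (by norm_num)
  rw [ENNReal.add_lt_top, ENNReal.add_lt_top]
  exact ⟨⟨ENNReal.rpow_lt_top_of_nonneg (by norm_num) h2.ne,
    ENNReal.rpow_lt_top_of_nonneg (by norm_num) h1.ne⟩,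
    ENNReal.rpow_lt_top_of_nonneg (by norm_num) h3.ne⟩

lemma sob_tri (a b : ℝ) (hH : Measurable H) (hF : Measurable F) (hG : Measurable G) :
    ∫⁻ x, ∫⁻ y, 3 * (sobker b x y + sobker a x (x - y) + sobker (1 - (a + b)) y x) *
      (H x * (F (x - y) * G y)) ≤
    sobC a b * (∫⁻ x, H x ^ (2:ℝ)) ^ (1 / 2 : ℝ) * ((∫⁻ x, F x ^ (2:ℝ)) ^ (1 / 2 : ℝ) *
      (∫⁻ x, G x ^ (2:ℝ)) ^ (1 / 2 : ℝ)) := by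
  have hH1 : Measurable fun p : R2 × R2 => H p.1 := by fun_prop
  have hG2 : Measurable fun p : R2 × R2 => G p.2 := by fun_prop
  have hFs : Measurable fun p : R2 × R2 => F (p.1 - p.2) := by fun_prop
  have hk1 : Measurable fun p : R2 × R2 => sobker b p.1 p.2 := sobker_meas b
  have hk2 : Measurable fun p : R2 × R2 => sobker a p.1 (p.1 - p.2) :=
    (sobker_meas a).comp (measurable_fst.prodMk (measurable_fst.sub measurable_snd))
  have hk3 : Measurable fun p : R2 × R2 => sobker (1 - (a + b)) p.2 p.1 :=
    (sobker_meas _).comp measurable_swap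
  have T1 := sob_cs (hH1.mul hk1) (hFs.mul hG2)
  have T2 := sob_cs (hH1.mul hk2) (hFs.mul hG2)
  have T3 := sob_cs (hG2.mul hk3) (hH1.mul hFs)
  simp only [Pi.mul_apply] at T1 T2 T3
  rw [sob_ker_sq b hH, sob_conv_sq hF hG] at T1
  rw [sob_ker_sq2 a hH, sob_conv_sq hF hG] at T2
  rw [sob_ker_sq3 _ hG, sob_conv_sq' hF hH] at T3
  simp only [ENNReal.mul_rpow_of_nonneg _ _ (show (0:ℝ) ≤ 1 / 2 by norm_num)] at T1 T2 T3
  have m1 : Measurable fun p : R2 × R2 => H p.1 * sobker b p.1 p.2 * (F (p.1 - p.2) * G p.2) :=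
    (hH1.mul hk1).mul (hFs.mul hG2)
  have m2 : Measurable fun p : R2 × R2 =>
    H p.1 * sobker a p.1 (p.1 - p.2) * (F (p.1 - p.2) * G p.2) :=
    (hH1.mul hk2).mul (hFs.mul hG2)
  have m3 : Measurable fun p : R2 × R2 =>
    G p.2 * sobker (1 - (a + b)) p.2 p.1 * (H p.1 * F (p.1 - p.2)) :=
    (hG2.mul hk3).mul (hH1.mul hFs)
  have e : ∀ x y, 3 * (sobker b x y + sobker a x (x - y) + sobker (1 - (a + b)) y x) *
      (H x * (F (x - y) * G y)) = 3 * (H x * sobker b x y * (F (x - y) * G y) +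
      H x * sobker a x (x - y) * (F (x - y) * G y) +
      G y * sobker (1 - (a + b)) y x * (H x * F (x - y))) := by
    intro x y; ring
  have split : ∫⁻ x, ∫⁻ y, 3 * (sobker b x y + sobker a x (x - y) + sobker (1 - (a + b)) y x) *
      (H x * (F (x - y) * G y)) =
      3 * ((∫⁻ x, ∫⁻ y, H x * sobker b x y * (F (x - y) * G y)) +
      (∫⁻ x, ∫⁻ y, H x * sobker a x (x - y) * (F (x - y) * G y)) +
      ∫⁻ x, ∫⁻ y, G y * sobker (1 - (a + b)) y x * (H x * F (x - y))) := by
    simp_rw [e]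
    rw [lintegral_lintegral (by exact (((m1.add m2).add m3).const_mul 3).aemeasurable),
      lintegral_lintegral (by exact m1.aemeasurable),
      lintegral_lintegral (by exact m2.aemeasurable),
      lintegral_lintegral (by exact m3.aemeasurable),
      lintegral_const_mul _ (by exact (m1.add m2).add m3), lintegral_add_right _ m3,
      lintegral_add_right _ m2]
  rw [split]
  refine (mul_le_mul_right (add_le_add (add_le_add T1 T2) T3) 3).trans (le_of_eq ?_)
  unfold sobC
  ring

end tri

lemma sob_wconv {a b : ℝ} (ha : -1 < a) (ha' : a < 1) (hb : -1 < b) (hb' : b < 1)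
    {H F G : R2 → ℝ≥0∞} (hH : Measurable H) (hF : Measurable F) (hG : Measurable G) :
    ∫⁻ ξ, H ξ * (‖ξ‖ₑ ^ (a + b - 1) * ∫⁻ η, F (ξ - η) * G η) ≤
    sobC a b * (∫⁻ x, H x ^ (2:ℝ)) ^ (1 / 2 : ℝ) *
      ((∫⁻ x, ‖x‖ₑ ^ (2 * a) * F x ^ (2:ℝ)) ^ (1 / 2 : ℝ) *
      (∫⁻ x, ‖x‖ₑ ^ (2 * b) * G x ^ (2:ℝ)) ^ (1 / 2 : ℝ)) := by
  have e : ∀ (c : ℝ) (Φ : R2 → ℝ≥0∞) (x : R2), ‖x‖ₑ ^ (2 * c) * Φ x ^ (2:ℝ)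
      = (‖x‖ₑ ^ c * Φ x) ^ (2:ℝ) := by
    intro c Φ x
    rw [ENNReal.mul_rpow_of_nonneg _ _ (by norm_num), ← ENNReal.rpow_mul, mul_comm c]
  have h := sob_tri a b hH (F := fun x => ‖x‖ₑ ^ a * F x) (G := fun x => ‖x‖ₑ ^ b * G x)
    (by fun_prop) (by fun_prop)
  simp only [e]
  refine le_trans ?_ h
  apply lintegral_mono_ae
  filter_upwards [sob_ae_ne 0] with ξ hξ
  rw [← mul_assoc, ← lintegral_const_mul _ (by fun_prop)]
  apply lintegral_mono_ae
  filter_upwards [sob_ae_ne 0, sob_ae_ne ξ] with η hη hη2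
  have h3 : ξ - η ≠ 0 := sub_ne_zero.mpr (Ne.symm hη2)
  have hk := sob_kernel ha ha' hb hb' hξ hη h3
  have c : ∀ (c : ℝ) (x : R2), x ≠ 0 → ‖x‖ₑ ^ (-c) * ‖x‖ₑ ^ c = 1 := by
    intro c x hx
    rw [← ENNReal.rpow_add _ _ (by simpa using hx) (by simp)]
    simp
  calc _ = ‖ξ‖ₑ ^ (a + b - 1) * ((‖ξ - η‖ₑ ^ (-a) * ‖ξ - η‖ₑ ^ a) * (‖η‖ₑ ^ (-b) * ‖η‖ₑ ^ b)) *
        (H ξ * (F (ξ - η) * G η)) := by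
          rw [c a _ h3, c b _ hη]; ring
    _ = (‖ξ‖ₑ ^ (a + b - 1) * (‖ξ - η‖ₑ ^ (-a) * ‖η‖ₑ ^ (-b))) *
        (H ξ * ((‖ξ - η‖ₑ ^ a * F (ξ - η)) * (‖η‖ₑ ^ b * G η))) := by ring
    _ ≤ _ := by gcongr

lemma sob_dual {K : R2 → ℝ≥0∞} (hK : Measurable K) {M : ℝ≥0∞}
    (h : ∀ H : R2 → ℝ≥0∞, Measurable H → ∫⁻ ξ, H ξ * K ξ ≤
      M * (∫⁻ x, H x ^ (2:ℝ)) ^ (1 / 2 : ℝ)) : ∫⁻ ξ, K ξ ^ (2:ℝ) ≤ M ^ (2:ℝ) := by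
  let Hn : ℕ → R2 → ℝ≥0∞ := fun n => (Metric.ball (0:R2) n).indicator fun x => min (K x) n
  have hm : ∀ n, Measurable (Hn n) := fun n =>
    (hK.min measurable_const).indicator measurableSet_ball
  have hb : ∀ n, ∫⁻ x, Hn n x ^ (2:ℝ) ≤ M ^ (2:ℝ) := by
    intro n
    set X := ∫⁻ x, Hn n x ^ (2:ℝ) with hX
    have hfin : X < ∞ := by
      have h1 : X ≤ ∫⁻ x, (Metric.ball (0:R2) n).indicator (fun _ => (n : ℝ≥0∞) ^ (2:ℝ)) x := by
        apply lintegral_mono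
        intro x
        by_cases hx : x ∈ Metric.ball (0:R2) n
        · simp only [Hn, Set.indicator_of_mem hx]
          gcongr
          exact min_le_right _ _
        · simp [Hn, Set.indicator_of_notMem hx]
      refine h1.trans_lt ?_
      rw [lintegral_indicator measurableSet_ball, setLIntegral_const]
      exact ENNReal.mul_lt_top (ENNReal.rpow_lt_top_of_nonneg (by norm_num) (by simp))
        measure_ball_lt_top
    have h1 : X ≤ M * X ^ (1 / 2 : ℝ) := by
      refine le_trans ?_ (h _ (hm n))
      apply lintegral_mono
      intro x
      change Hn n x ^ (2:ℝ) ≤ _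
      rw [ENNReal.rpow_two, sq]
      refine mul_le_mul' le_rfl ?_
      by_cases hx : x ∈ Metric.ball (0:R2) n
      · simp only [Hn, Set.indicator_of_mem hx]
        exact min_le_left _ _
      · simp [Hn, Set.indicator_of_notMem hx]
    by_cases h0 : X = 0
    · simp [h0]
    have e2 : X = X ^ (1 / 2 : ℝ) * X ^ (1 / 2 : ℝ) := by
      rw [← ENNReal.rpow_add _ _ h0 hfin.ne]; norm_num
    have hr0 : X ^ (1 / 2 : ℝ) ≠ 0 := by simp [ENNReal.rpow_eq_zero_iff, h0, hfin.ne]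
    have hrt : X ^ (1 / 2 : ℝ) ≠ ∞ := ENNReal.rpow_ne_top_of_nonneg (by norm_num) hfin.ne
    have h2 : X ^ (1 / 2 : ℝ) ≤ M := by
      rw [← ENNReal.mul_le_mul_iff_left hr0 hrt]
      rwa [← e2]
    calc X = (X ^ (1 / 2 : ℝ)) ^ (2:ℝ) := by rw [← ENNReal.rpow_mul]; norm_num
      _ ≤ _ := by gcongr
  have hfat := lintegral_liminf_le (μ := (volume : Measure R2)) (u := Filter.atTop)
    (f := fun (n : ℕ) x => Hn n x ^ (2:ℝ)) (fun n => (hm n).pow_const _)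
  have hl : ∀ x, Filter.liminf (fun n => Hn n x ^ (2:ℝ)) Filter.atTop = K x ^ (2:ℝ) := by
    intro x
    apply Filter.Tendsto.liminf_eq
    apply (ENNReal.continuous_rpow_const.tendsto _).comp
    have : Filter.Tendsto (fun n : ℕ => min (K x) n) Filter.atTop (nhds (min (K x) ∞)) :=
      tendsto_const_nhds.min ENNReal.tendsto_nat_nhds_top
    rw [min_eq_left le_top] at this
    refine this.congr' ?_
    obtain ⟨N, hN⟩ := exists_nat_gt ‖x‖
    filter_upwards [Filter.eventually_ge_atTop N] with n hn
    have : x ∈ Metric.ball (0:R2) n := by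
      simp only [Metric.mem_ball, dist_zero_right]
      exact hN.trans_le (by exact_mod_cast hn)
    simp [Hn, Set.indicator_of_mem this]
  simp_rw [hl] at hfat
  refine hfat.trans (Filter.liminf_le_of_le (by isBoundedDefault) ?_)
  intro c hc
  obtain ⟨n, hn⟩ := hc.exists
  exact hn.trans (hb n)

lemma sob_wconv' {a b : ℝ} (ha : -1 < a) (ha' : a < 1) (hb : -1 < b) (hb' : b < 1)
    {F G : R2 → ℝ≥0∞} (hF : Measurable F) (hG : Measurable G) :
    ∫⁻ ξ, ‖ξ‖ₑ ^ (2 * (a + b - 1)) * (∫⁻ η, F (ξ - η) * G η) ^ (2:ℝ) ≤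
    sobC a b ^ (2:ℝ) * ((∫⁻ x, ‖x‖ₑ ^ (2 * a) * F x ^ (2:ℝ)) *
      (∫⁻ x, ‖x‖ₑ ^ (2 * b) * G x ^ (2:ℝ))) := by
  have hc : Measurable fun ξ => ∫⁻ η, F (ξ - η) * G η := by
    apply Measurable.lintegral_prod_right' (f := fun p : R2 × R2 => F (p.1 - p.2) * G p.2)
    fun_prop
  have h := sob_dual (K := fun ξ => ‖ξ‖ₑ ^ (a + b - 1) * ∫⁻ η, F (ξ - η) * G η) (by fun_prop)
    (M := sobC a b * ((∫⁻ x, ‖x‖ₑ ^ (2 * a) * F x ^ (2:ℝ)) ^ (1 / 2 : ℝ) *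
      (∫⁻ x, ‖x‖ₑ ^ (2 * b) * G x ^ (2:ℝ)) ^ (1 / 2 : ℝ)))
    (fun H hH => (sob_wconv ha ha' hb hb' hH hF hG).trans (le_of_eq (by ring)))
  simp only [ENNReal.mul_rpow_of_nonneg _ _ (show (0:ℝ) ≤ 2 by norm_num), ← ENNReal.rpow_mul] at h
  norm_num at h
  simp only [mul_comm (a + b - 1) 2] at h
  simpa using h

lemma sob_mul_fourier {f g : R2 → ℂ} (hf : Integrable f) (hg : Integrable g) (hc : Continuous g)
    (hG : Integrable (𝓕 g)) (ξ : R2) : 𝓕 (f * g) ξ = ∫ η, 𝓕 g η * 𝓕 f (ξ - η) := by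
  let u : R2 → ℂ := fun x => 𝐞 (inner ℝ x ξ) • f (-x)
  have hu : Integrable u := by
    have h := (Real.fourierIntegral_convergent_iff (f := fun x => f (-x)) (-ξ)).2 hf.comp_neg
    simpa [u] using h
  have h := sob_selfadj hu hG
  have e1 : ∀ η, 𝓕 u η = 𝓕 f (ξ - η) := by
    intro η
    rw [Real.fourier_eq, Real.fourier_eq, ← integral_neg_eq_self]
    congr 1
    ext x
    simp only [u, smul_smul, ← AddChar.map_add_eq_mul, neg_neg]
    congr 2
    simp only [inner_neg_left, inner_sub_right]
    ring
  simp only [e1] at h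
  rw [h, ← integral_neg_eq_self, Real.fourier_eq]
  congr 1
  ext x
  have hinv : 𝓕 (𝓕 g) (-x) = g x := by
    rw [← Real.fourierInv_eq_fourier_neg, hc.fourierInv_fourier_eq hg hG]
  simp only [u, neg_neg, hinv, Pi.mul_apply, inner_neg_left, Circle.smul_def, smul_eq_mul]
  ring

lemma sob_prod1 {a b : ℝ} (ha : -1 < a) (ha' : a < 1) (hb : -1 < b) (hb' : b < 1)
    {f g : R2 → ℂ} (hf : Integrable f) (hg : Integrable g) (hc : Continuous g)
    (hG : Integrable (𝓕 g)) :
    hSobSq (a + b - 1) (f * g) ≤ sobC a b ^ (2:ℝ) * (hSobSq a f * hSobSq b g) := by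
  refine le_trans ?_ (sob_wconv' ha ha' hb hb' (F := fun x => ‖𝓕 f x‖ₑ) (G := fun x => ‖𝓕 g x‖ₑ)
    (sob_cont hf).measurable.enorm (sob_cont hg).measurable.enorm)
  apply lintegral_mono
  intro ξ
  refine mul_le_mul' le_rfl (ENNReal.rpow_le_rpow ?_ (by norm_num))
  change ‖𝓕 (f * g) ξ‖ₑ ≤ _
  rw [sob_mul_fourier hf hg hc hG]
  refine (enorm_integral_le_lintegral_enorm _).trans (le_of_eq ?_)
  congr 1
  ext η
  rw [enorm_mul, mul_comm]

section moll
open Convolution ContinuousLinearMap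

lemma sob_moll {g : R2 → ℂ} (hg : Integrable g) {M : ℝ} (hM : ∀ x, ‖g x‖ ≤ M)
    (φ : ContDiffBump (0 : R2)) (b : ℝ) :
    Continuous (φ.normed volume ⋆[lsmul ℝ ℝ, volume] g) ∧
    Integrable (φ.normed volume ⋆[lsmul ℝ ℝ, volume] g) ∧
    Integrable (𝓕 (φ.normed volume ⋆[lsmul ℝ ℝ, volume] g)) ∧
    (∀ x, ‖(φ.normed volume ⋆[lsmul ℝ ℝ, volume] g) x‖ ≤ M) ∧
    hSobSq b (φ.normed volume ⋆[lsmul ℝ ℝ, volume] g) ≤ hSobSq b g := by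
  have hφi : Integrable (φ.normed (volume : Measure R2)) := φ.integrable_normed
  let ψ : R2 → ℂ := fun x => (φ.normed (volume : Measure R2) x : ℂ)
  have hψi : Integrable ψ := hφi.ofReal
  have hcv : (φ.normed volume ⋆[lsmul ℝ ℝ, volume] g) = (ψ ⋆[mul ℂ ℂ, volume] g) := by
    ext x
    simp only [convolution_def, lsmul_apply, mul_apply', ψ, Complex.real_smul]
  have hF : ∀ ξ, 𝓕 (φ.normed volume ⋆[lsmul ℝ ℝ, volume] g) ξ = 𝓕 ψ ξ * 𝓕 g ξ := by
    intro ξ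
    rw [hcv]
    exact Real.fourier_mul_convolution_eq hψi hg ξ
  have hFb : ∀ (h : R2 → ℂ) ξ, ‖𝓕 h ξ‖ ≤ ∫ x, ‖h x‖ := fun h ξ =>
    VectorFourier.norm_fourierIntegral_le_integral_norm _ _ _ _ _
  have hψ1 : ∫ x, ‖ψ x‖ = 1 := by
    rw [← φ.integral_normed (μ := (volume : Measure R2))]
    congr 1
    ext x
    simp only [ψ, Complex.norm_real, Real.norm_of_nonneg (φ.nonneg_normed x)]
  have hψs : Integrable (𝓕 ψ) := by
    have h1 : HasCompactSupport (Complex.ofRealCLM ∘ φ.normed (volume : Measure R2)) :=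
      φ.hasCompactSupport_normed.comp_left rfl
    have h2 : ContDiff ℝ (⊤ : ℕ∞) (Complex.ofRealCLM ∘ φ.normed (volume : Measure R2)) :=
      Complex.ofRealCLM.contDiff.comp φ.contDiff_normed
    have h3 := (𝓕 (h1.toSchwartzMap h2)).integrable (μ := (volume : Measure R2))
    rw [SchwartzMap.fourier_coe] at h3
    exact h3
  refine ⟨?_, ?_, ?_, ?_, ?_⟩
  · exact φ.hasCompactSupport_normed.continuous_convolution_left _ φ.continuous_normed
      hg.locallyIntegrable
  · exact hφi.integrable_convolution _ hg
  · rw [show 𝓕 (φ.normed volume ⋆[lsmul ℝ ℝ, volume] g) = fun ξ => 𝓕 ψ ξ * 𝓕 g ξ from funext hF]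
    exact hψs.mul_bdd (sob_cont hg).aestronglyMeasurable (Filter.Eventually.of_forall (hFb g))
  · intro x
    rw [convolution_def]
    calc _ ≤ ∫ t, φ.normed (volume : Measure R2) t * M := by
          apply norm_integral_le_of_norm_le (hφi.mul_const M)
          filter_upwards with t
          rw [lsmul_apply, norm_smul, Real.norm_of_nonneg (φ.nonneg_normed t)]
          exact mul_le_mul_of_nonneg_left (hM _) (φ.nonneg_normed t)
      _ = M := by rw [integral_mul_const, φ.integral_normed, one_mul]
  · apply lintegral_mono
    intro ξ
    refine mul_le_mul' le_rfl (ENNReal.rpow_le_rpow ?_ (by norm_num))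
    change ‖𝓕 (φ.normed volume ⋆[lsmul ℝ ℝ, volume] g) ξ‖ₑ ≤ ‖𝓕 g ξ‖ₑ
    rw [enorm_le_iff_norm_le, hF, norm_mul]
    have := (hFb ψ ξ).trans hψ1.le
    exact mul_le_of_le_one_left (norm_nonneg _) this

lemma sob_prod2 {a b : ℝ} (ha : -1 < a) (ha' : a < 1) (hb : -1 < b) (hb' : b < 1)
    {f g : R2 → ℂ} (hf : Integrable f) (hg : Integrable g) {M : ℝ} (hM : ∀ x, ‖g x‖ ≤ M) :
    hSobSq (a + b - 1) (f * g) ≤ sobC a b ^ (2:ℝ) * (hSobSq a f * hSobSq b g) := by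
  let φ : ℕ → ContDiffBump (0 : R2) := fun n =>
    ⟨1 / ((n:ℝ) + 1), 2 * (1 / ((n:ℝ) + 1)), by positivity, by
      have : 0 < 1 / ((n:ℝ) + 1) := by positivity
      linarith⟩
  have hr : Filter.Tendsto (fun n => (φ n).rOut) Filter.atTop (nhds 0) := by
    have h := (tendsto_one_div_add_atTop_nhds_zero_nat (𝕜 := ℝ)).const_mul 2
    rw [mul_zero] at h
    exact h
  have hlim := ContDiffBump.ae_convolution_tendsto_right_of_locallyIntegrable (φ := φ)
    (l := Filter.atTop) (K := 2) (μ := (volume : Measure R2)) (g := g)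
    hr
    (Filter.Eventually.of_forall fun n => le_rfl) hg.locallyIntegrable
  have hm := fun n => sob_moll hg hM (φ n) b
  refine sob_fatou (B := fun x => ‖f x‖ * M)
    (u := fun n => f * ((φ n).normed volume ⋆[lsmul ℝ ℝ, volume] g)) (hf.norm.mul_const M)
    (fun n => hf.aestronglyMeasurable.mul (hm n).1.aestronglyMeasurable) ?_ ?_ ?_ ?_
  · exact hf.mul_bdd hg.aestronglyMeasurable (Filter.Eventually.of_forall hM)
  · intro n
    filter_upwards with x
    rw [Pi.mul_apply, norm_mul]
    exact mul_le_mul_of_nonneg_left ((hm n).2.2.2.1 x) (norm_nonneg _)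
  · filter_upwards [hlim] with x hx
    exact hx.const_mul _
  · intro n
    obtain ⟨h1, h2, h3, h4, h5⟩ := hm n
    refine (sob_prod1 ha ha' hb hb' hf h2 h1 h3).trans ?_
    gcongr

end moll

lemma sob_prod3 {a b : ℝ} (ha : -1 < a) (ha' : a < 1) (hb : 0 < b) (hb' : b < 1)
    {f g : R2 → ℂ} (hf : Integrable f) (hg : Integrable g) (hfg : Integrable (f * g)) :
    hSobSq (a + b - 1) (f * g) ≤ sobC a b ^ (2:ℝ) * (hSobSq a f * hSobSq b g) := by
  have hn0 : ∀ n : ℕ, (0:ℝ) ≤ n := fun n => Nat.cast_nonneg n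
  have hT : ∀ n : ℕ, Integrable fun x => sobT n (g x) := fun n =>
    hg.mono ((sobT_cont n).comp_aestronglyMeasurable hg.aestronglyMeasurable)
      (Filter.Eventually.of_forall fun x => sobT_le (hn0 n) (g x))
  refine sob_fatou (B := fun x => ‖(f * g) x‖)
    (u := fun n : ℕ => f * fun x => sobT n (g x)) hfg.norm
    (fun n => hf.aestronglyMeasurable.mul (hT n).aestronglyMeasurable) hfg ?_ ?_ ?_
  · intro n
    filter_upwards with x
    rw [Pi.mul_apply, Pi.mul_apply, norm_mul, norm_mul]
    exact mul_le_mul_of_nonneg_left (sobT_le (hn0 n) _) (norm_nonneg _)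
  · filter_upwards with x
    obtain ⟨N, hN⟩ := exists_nat_ge ‖g x‖
    apply tendsto_const_nhds.congr'
    filter_upwards [Filter.eventually_ge_atTop N] with n hn
    rw [Pi.mul_apply, Pi.mul_apply, sobT_eq]
    exact hN.trans (by exact_mod_cast hn)
  · intro n
    refine (sob_prod2 ha ha' (by linarith) hb' hf (hT n) (M := 2 * n) ?_).trans ?_
    · intro x
      exact sobT_le' (hn0 n) _
    · gcongr
      exact sob_lip hb hb' hg (sobT_lip n) (hT n)

lemma sob_final {a b : ℝ} (ha : -1 < a) (ha' : a < 1) (hb : 0 < b) (hb' : b < 1)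
    (hab : 0 < a + b) :
    ∃ C : ℝ≥0, 0 < C ∧ ∀ f g : R2 → ℂ, Integrable f → Integrable g →
      Integrable (f * g) → hSobSq a f < ∞ → hSobSq b g < ∞ →
      hSobSq (a + b - 1) (f * g) < ∞ ∧
      (hSobSq (a + b - 1) (f * g)) ^ (1 / 2 : ℝ) ≤
        C * (hSobSq a f) ^ (1 / 2 : ℝ) * (hSobSq b g) ^ (1 / 2 : ℝ) := by
  have hC := sobC_lt_top ha' hb' hab
  refine ⟨(sobC a b).toNNReal + 1, by positivity, ?_⟩
  intro f g hf hg hfg h1 h2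
  have h := sob_prod3 ha ha' hb hb' hf hg hfg
  refine ⟨h.trans_lt ?_, ?_⟩
  · exact ENNReal.mul_lt_top (ENNReal.rpow_lt_top_of_nonneg (by norm_num) hC.ne)
      (ENNReal.mul_lt_top h1 h2)
  · refine (ENNReal.rpow_le_rpow h (show (0:ℝ) ≤ 1 / 2 by norm_num)).trans ?_
    rw [ENNReal.mul_rpow_of_nonneg _ _ (by norm_num), ENNReal.mul_rpow_of_nonneg _ _ (by norm_num),
      ← ENNReal.rpow_mul, ← mul_assoc]
    have : sobC a b ^ ((2:ℝ) * (1 / 2)) ≤ (((sobC a b).toNNReal + 1 : ℝ≥0) : ℝ≥0∞) := by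
      rw [show (2:ℝ) * (1 / 2) = 1 by norm_num, ENNReal.rpow_one, ENNReal.coe_add,
        ENNReal.coe_toNNReal hC.ne]
      exact le_self_add
    gcongr

/-- Homogeneous Sobolev product estimate: for `a, b ∈ (-1,1)` with `a + b > 0`,
`fg ∈ Ḣ^{a+b-1}` and `‖fg‖_{Ḣ^{a+b-1}} ≤ C ‖f‖_{Ḣ^a} ‖g‖_{Ḣ^b}`. -/
theorem stmt2 (a b : ℝ) (ha : a ∈ Set.Ioo (-1 : ℝ) 1) (hb : b ∈ Set.Ioo (-1 : ℝ) 1)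
    (hab : 0 < a + b) :
    ∃ C : ℝ≥0, 0 < C ∧ ∀ f g : R2 → ℂ, Integrable f → Integrable g →
      Integrable (f * g) → hSobSq a f < ∞ → hSobSq b g < ∞ →
      hSobSq (a + b - 1) (f * g) < ∞ ∧
      (hSobSq (a + b - 1) (f * g)) ^ (1 / 2 : ℝ) ≤
        C * (hSobSq a f) ^ (1 / 2 : ℝ) * (hSobSq b g) ^ (1 / 2 : ℝ) := by
  rcases lt_or_ge 0 b with hb0 | hb0
  · exact sob_final ha.1 ha.2 hb0 hb.2 hab
  · obtain ⟨C, hC, h⟩ := sob_final hb.1 hb.2 (show 0 < a by linarith) ha.2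
      (show 0 < b + a by linarith)
    refine ⟨C, hC, fun f g hf hg hfg h1 h2 => ?_⟩
    have h3 := h g f hg hf (by rwa [mul_comm]) h2 h1
    rw [mul_comm g f, add_comm b a] at h3
    refine ⟨h3.1, h3.2.trans (le_of_eq ?_)⟩
    ring
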